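/- Let Σ = {a,b} and let w ∈ Σ* be a nonempty word of length n. Then there exists a strongly connected DFA ℬ = ⟨Q, Σ, δ⟩ with exactly n + 1 states whose set of synchronizing words equals Σ* w Σ*, the principal ideal language generated by w. -/

import Mathlib

/-- The two-letter alphabet Σ = {a, b}. -/
inductive Letter : Type
  | a : Letter
  | b : Letter
deriving DecidableEq

/-- Extended transition function of a DFA: the action of a word on a state. -/
def run {Q : Type} (δ : Q → Letter → Q) (q : Q) (w : List Letter) : Q :=
  w.foldl δ q

/-- Length of the longest prefix of `w` which is a suffix of `s`. -/
noncomputable def kmp (w s : List Letter) : ℕ := by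
  classical exact Nat.findGreatest (fun k => w.take k <:+ s) w.length

theorem kmp_le (w s : List Letter) : kmp w s ≤ w.length := by
  classical
  unfold kmp
  exact Nat.findGreatest_le _

theorem kmp_suffix (w s : List Letter) : w.take (kmp w s) <:+ s := by
  classical
  unfold kmp
  exact Nat.findGreatest_spec (P := fun k => w.take k <:+ s) (Nat.zero_le _) (by simp)

theorem le_kmp (w s : List Letter) (k : ℕ) (hk : k ≤ w.length) (h : w.take k <:+ s) :
    k ≤ kmp w s := by
  classical
  unfold kmp
  exact Nat.le_findGreatest hk h

theorem kmp_le_length (w s : List Letter) : kmp w s ≤ s.length := by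
  have h := (kmp_suffix w s).length_le
  have := kmp_le w s
  simp at h
  omega

theorem kmp_eq (w s : List Letter) (k : ℕ) (hk : k ≤ w.length) (h : w.take k <:+ s)
    (h' : ∀ j, j ≤ w.length → w.take j <:+ s → j ≤ k) : kmp w s = k :=
  le_antisymm (h' _ (kmp_le w s) (kmp_suffix w s)) (le_kmp w s k hk h)

theorem take_succ_suffix (w s : List Letter) (x : Letter) (j : ℕ) (hj : j + 1 ≤ w.length)
    (h : w.take (j + 1) <:+ s ++ [x]) : w.take j <:+ s := by
  rw [List.take_succ_eq_append_getElem (by omega)] at h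
  obtain ⟨t, ht⟩ := h
  rw [← List.append_assoc] at ht
  have := List.append_inj_left' ht (by simp)
  exact ⟨t, this⟩

theorem kmp_snoc (w s : List Letter) (x : Letter) :
    kmp w (s ++ [x]) = kmp w (w.take (kmp w s) ++ [x]) := by
  have hs := kmp_suffix w s
  have hsx : w.take (kmp w s) ++ [x] <:+ s ++ [x] := by
    obtain ⟨t, ht⟩ := hs
    exact ⟨t, by rw [← List.append_assoc, ht]⟩
  apply kmp_eq _ _ _ (kmp_le _ _)
  · exact (kmp_suffix _ _).trans hsx
  · intro j hj h
    apply le_kmp _ _ _ hj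
    apply List.suffix_of_suffix_length_le h hsx
    rcases j with _ | j
    · simp
    · have := le_kmp w s j (by omega) (take_succ_suffix w s x j hj h)
      have := kmp_le w s
      simp
      omega

theorem kmp_take (w : List Letter) (i : ℕ) (hi : i ≤ w.length) : kmp w (w.take i) = i := by
  apply le_antisymm
  · have := kmp_le_length w (w.take i)
    simp at this
    omega
  · exact le_kmp _ _ _ hi (List.suffix_refl _)

theorem take_snoc (w : List Letter) (i : ℕ) (x : Letter) (h : w[i]? = some x) :
    w.take i ++ [x] = w.take (i + 1) := by
  rw [List.take_add_one, h]; simp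

/-- KMP transition. -/
noncomputable def kt (w : List Letter) (i : ℕ) (x : Letter) : ℕ := kmp w (w.take i ++ [x])

/-- Border. -/
noncomputable def bd (w : List Letter) (i : ℕ) : ℕ := kmp w (w.take i).tail

theorem kt_match (w : List Letter) (i : ℕ) (x : Letter) (h : w[i]? = some x) :
    kt w i x = i + 1 := by
  unfold kt
  rw [take_snoc w i x h, kmp_take]
  have := (List.getElem?_eq_some_iff.1 h).1
  omega

theorem kt_le (w : List Letter) (i : ℕ) (x : Letter) : kt w i x ≤ i + 1 := by
  have := kmp_le_length w (w.take i ++ [x])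
  simp at this
  unfold kt
  omega

theorem kt_ne (w : List Letter) (i : ℕ) (x : Letter) (hi : i < w.length)
    (h : w[i]? ≠ some x) : kt w i x ≤ i := by
  by_contra hc
  have h1 := kt_le w i x
  have h2 : kt w i x = i + 1 := by omega
  have h3 := kmp_suffix w (w.take i ++ [x])
  change w.take (kt w i x) <:+ _ at h3
  rw [h2] at h3
  have h4 := h3.eq_of_length (by simp; omega)
  rw [List.take_succ_eq_append_getElem hi] at h4
  have h5 := List.append_inj_right h4 rfl
  apply h
  rw [List.getElem?_eq_getElem hi]
  simpa using h5

theorem bd_le (w : List Letter) (i : ℕ) : bd w i ≤ i - 1 := by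
  have := kmp_le_length w (w.take i).tail
  simp at this
  unfold bd
  omega

theorem kt_bd (w : List Letter) (i : ℕ) (x : Letter) : 
    kt w (bd w i) x = kmp w ((w.take i).tail ++ [x]) := by
  unfold kt bd
  rw [← kmp_snoc]

theorem kt_fail (w : List Letter) (i : ℕ) (x : Letter) (hi : i < w.length) (h0 : 0 < i)
    (h : w[i]? ≠ some x) : kt w (bd w i) x = kt w i x := by
  rw [kt_bd]
  have hle := kt_ne w i x hi h
  have hne : w.take i ≠ [] := by
    intro hh
    have h1 := congrArg List.length hh
    rw [List.length_take, List.length_nil] at h1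
    omega
  have hsuf : (w.take i).tail ++ [x] <:+ w.take i ++ [x] := by
    rw [← List.tail_append_of_ne_nil hne]
    exact List.tail_suffix _
  apply kmp_eq _ _ _ (kmp_le _ _)
  · apply List.suffix_of_suffix_length_le (kmp_suffix w (w.take i ++ [x])) hsuf
    change (w.take (kt w i x)).length ≤ _
    simp
    omega
  · intro j hj hs
    exact le_kmp _ _ _ hj (hs.trans hsuf)

theorem bd_succ (w : List Letter) (i : ℕ) (x : Letter) (h0 : 0 < i)
    (h : w[i]? = some x) : bd w (i + 1) = kt w (bd w i) x := by
  rw [kt_bd]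
  have hi := (List.getElem?_eq_some_iff.1 h).1
  have hne : w.take i ≠ [] := by
    intro hh
    have h1 := congrArg List.length hh
    rw [List.length_take, List.length_nil] at h1
    omega
  unfold bd
  rw [← take_snoc w i x h, List.tail_append_of_ne_nil hne]

/-- Unordered pair `{p,q}` is the tree edge number `k`. -/
def IsEdge (P : ℕ → ℕ) (k p q : ℕ) : Prop :=
  (p = k + 1 ∧ q = P k) ∨ (p = P k ∧ q = k + 1)

/-- Partial construction up to level `m`. -/
structure Spec (w : List Letter) (m : ℕ) (P : ℕ → ℕ) (d : ℕ → Letter → ℕ) : Prop where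
  P0 : P 0 = 0
  Ple : ∀ i ≤ m, P i ≤ i
  d0 : ∀ x, w[0]? = some x → d 0 x = 0
  d0' : ∀ x, w[0]? ≠ some x → d 0 x = 1
  Ps : ∀ i < m, ∀ x, w[i]? = some x → P (i + 1) = d (P i) x
  good : ∀ i < m, ∀ x, kt w i x < w.length → IsEdge P (kt w i x) (d (i + 1) x) (d (P i) x)
  coll : ∀ i < m, ∀ x, kt w i x = w.length → d (i + 1) x = d (P i) x
  step : ∀ i < m, ∀ x, w[i]? = some x → i + 1 < w.length → d (i + 1) x = i + 2
  bord : ∀ i ≤ m, 0 < i → P i = bd w i + 1 ∨ P i = P (bd w i)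

theorem exists_spec (w : List Letter) (m : ℕ) (hm : m ≤ w.length) :
    ∃ P d, Spec w m P d := by
  classical
  induction m with
  | zero =>
    refine ⟨fun _ => 0, fun _ x => if w[0]? = some x then 0 else 1, ?_⟩
    constructor <;> simp +contextual
  | succ m ih =>
    obtain ⟨P, d, S⟩ := ih (by omega)
    have hml : m < w.length := by omega
    obtain ⟨c, hc⟩ : ∃ c, w[m]? = some c := ⟨w[m], List.getElem?_eq_getElem hml⟩
    -- key facts
    have key : ∀ x, w[m]? ≠ some x →
        d (P m) x = kt w m x + 1 ∨ d (P m) x = P (kt w m x) := by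
      intro x hx
      have hle := kt_ne w m x hml hx
      rcases Nat.eq_zero_or_pos m with h0 | h0
      · subst h0
        have : kt w 0 x = 0 := by omega
        rw [S.P0, S.d0' x hx, this]; simp
      · have hf := kt_fail w m x hml h0 hx
        have hb := bd_le w m
        have hg := S.good (bd w m) (by omega) x (by omega)
        rw [hf] at hg
        unfold IsEdge at hg
        rcases S.bord m le_rfl h0 with h | h <;> rw [h] <;> omega
    have keyb : d (P m) c = bd w (m + 1) + 1 ∨ d (P m) c = P (bd w (m + 1)) := by
      have hb1 := bd_le w (m + 1)
      rcases Nat.eq_zero_or_pos m with h0 | h0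
      · subst h0
        have : bd w (0 + 1) = 0 := by omega
        rw [this, S.P0, S.d0 c hc]; simp
      · have hf := bd_succ w m c h0 hc
        have hb := bd_le w m
        have hg := S.good (bd w m) (by omega) c (by omega)
        rw [← hf] at hg
        unfold IsEdge at hg
        rcases S.bord m le_rfl h0 with h | h <;> rw [h] <;> omega
    let P' : ℕ → ℕ := fun i => if i = m + 1 then d (P m) c else P i
    let r : Letter → ℕ := fun x =>
      if kt w m x = w.length then d (P m) x
      else if w[m]? = some x then m + 2
      else if d (P m) x = kt w m x + 1 then P (kt w m x) else kt w m x + 1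
    let d' : ℕ → Letter → ℕ := fun i => if i = m + 1 then r else d i
    have hP' : ∀ i ≤ m, P' i = P i := fun i hi => by
      simp only [P']; rw [if_neg (by omega)]
    have hP1 : P' (m + 1) = d (P m) c := by simp [P']
    have hd' : ∀ i ≤ m, d' i = d i := fun i hi => by
      simp only [d']; rw [if_neg (by omega)]
    have hd1 : d' (m + 1) = r := by simp [d']
    have hPm := S.Ple m le_rfl
    have hbm := bd_le w (m + 1)
    refine ⟨P', d', ?_⟩
    constructor
    · rw [hP' 0 (by omega), S.P0]
    · intro i hi
      rcases Nat.lt_or_ge m i with h | h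
      · obtain rfl : i = m + 1 := by omega
        rw [hP1]
        have := S.Ple (bd w (m + 1)) (by omega)
        omega
      · rw [hP' i h]; exact S.Ple i h
    · rw [hd' 0 (by omega)]; exact S.d0
    · rw [hd' 0 (by omega)]; exact S.d0'
    · intro i hi x hx
      rcases Nat.lt_or_ge i m with h | h
      · have := S.Ple i (by omega)
        rw [hP' (i + 1) (by omega), hP' i (by omega), hd' _ (by omega)]
        exact S.Ps i h x hx
      · obtain rfl : i = m := by omega
        rw [hP1, hP' i le_rfl, hd' _ hPm]
        rw [hx] at hc
        cases hc; rfl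
    · intro i hi x hk
      rcases Nat.lt_or_ge i m with h | h
      · have h1 := S.Ple i (by omega)
        have h2 := kt_le w i x
        have := S.good i h x hk
        unfold IsEdge at this ⊢
        rw [hP' i (by omega), hd' _ (by omega), hd' _ (by omega), hP' _ (by omega)]
        exact this
      · obtain rfl : i = m := by omega
        unfold IsEdge
        rw [hd1, hP' i le_rfl, hd' _ hPm]
        by_cases hx : w[i]? = some x
        · have hkt := kt_match w i x hx
          have hcx : c = x := by rw [hx] at hc; cases hc; rfl
          subst hcx
          simp only [r]
          rw [if_neg (by omega), if_pos hx, hkt, hP1]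
          left; exact ⟨rfl, rfl⟩
        · have h2 := kt_ne w i x hml hx
          have h3 := key x hx
          simp only [r]
          rw [if_neg (by omega), if_neg hx, hP' _ h2]
          split_ifs with h4
          · right; exact ⟨rfl, h4⟩
          · left; exact ⟨rfl, by omega⟩
    · intro i hi x hk
      rcases Nat.lt_or_ge i m with h | h
      · have h1 := S.Ple i (by omega)
        rw [hP' i (by omega), hd' _ (by omega), hd' _ (by omega)]
        exact S.coll i h x hk
      · obtain rfl : i = m := by omega
        rw [hd1, hP' i le_rfl, hd' _ hPm]
        simp only [r]
        rw [if_pos hk]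
    · intro i hi x hx hl
      rcases Nat.lt_or_ge i m with h | h
      · rw [hd' _ (by omega)]
        exact S.step i h x hx hl
      · obtain rfl : i = m := by omega
        have hkt := kt_match w i x hx
        rw [hd1]
        simp only [r]
        rw [if_neg (by omega), if_pos hx]
    · intro i hi h0
      have hb := bd_le w i
      rcases Nat.lt_or_ge m i with h | h
      · obtain rfl : i = m + 1 := by omega
        rw [hP1, hP' _ (by omega)]
        exact keyb
      · rw [hP' i h, hP' _ (by omega)]
        exact S.bord i h h0

theorem infix_snoc (w s : List Letter) (x : Letter) :
    w <:+: s ++ [x] ↔ w <:+: s ∨ w <:+ s ++ [x] := by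
  constructor
  · rintro ⟨p, q, h⟩
    rcases List.eq_nil_or_concat q with rfl | ⟨q', y, rfl⟩
    · right; exact ⟨p, by simpa using h⟩
    · left
      refine ⟨p, q', ?_⟩
      simp only [List.concat_eq_append, ← List.append_assoc] at h
      exact List.append_inj_left' h rfl
  · rintro (h | h)
    · exact h.trans (List.prefix_append _ _).isInfix
    · exact h.isInfix

theorem kmp_full (w s : List Letter) : kmp w s = w.length ↔ w <:+ s := by
  constructor
  · intro h
    have := kmp_suffix w s
    rwa [h, List.take_length] at this
  · intro h
    exact le_antisymm (kmp_le _ _) (le_kmp _ _ _ le_rfl (by simpa using h))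

theorem pair_run (w : List Letter) (P : ℕ → ℕ) (d : ℕ → Letter → ℕ)
    (S : Spec w w.length P d) (i : ℕ) (hi : i < w.length) (u : List Letter) :
    (¬ (w <:+: w.take i ++ u) ∧ kmp w (w.take i ++ u) < w.length ∧
      IsEdge P (kmp w (w.take i ++ u)) (u.foldl d (i + 1)) (u.foldl d (P i))) ∨
    (w <:+: w.take i ++ u ∧ u.foldl d (i + 1) = u.foldl d (P i)) := by
  induction u using List.reverseRecOn with
  | nil =>
    left
    simp only [List.append_nil, List.foldl_nil]
    rw [kmp_take w i hi.le]
    refine ⟨fun h => ?_, hi, Or.inl ⟨rfl, rfl⟩⟩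
    have := h.length_le
    simp at this
    omega
  | append_singleton u x ih =>
    rw [← List.append_assoc, List.foldl_append, List.foldl_append]
    simp only [List.foldl_cons, List.foldl_nil]
    rw [infix_snoc]
    rcases ih with ⟨h1, h2, h3⟩ | ⟨h1, h2⟩
    · have hk := kmp_snoc w (w.take i ++ u) x
      change _ = kt w _ x at hk
      have hle := kmp_le w (w.take i ++ u ++ [x])
      have hfull := kmp_full w (w.take i ++ u ++ [x])
      by_cases hs : w <:+ w.take i ++ u ++ [x]
      · right
        refine ⟨Or.inr hs, ?_⟩
        have := S.coll _ h2 x (by rw [← hk]; exact hfull.2 hs)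
        rcases h3 with ⟨ha, hb⟩ | ⟨ha, hb⟩ <;> rw [ha, hb, this]
      · left
        have hlt : kmp w (w.take i ++ u ++ [x]) < w.length :=
          lt_of_le_of_ne hle (fun h => hs (hfull.1 h))
        refine ⟨by tauto, hlt, ?_⟩
        have := S.good _ h2 x (by rw [← hk]; exact hlt)
        rw [← hk] at this
        unfold IsEdge at this ⊢
        rcases h3 with ⟨ha, hb⟩ | ⟨ha, hb⟩ <;> rw [ha, hb] <;> tauto
    · right
      exact ⟨Or.inl h1, by rw [h2]⟩

theorem d_le (w : List Letter) (hw : w ≠ []) (P : ℕ → ℕ) (d : ℕ → Letter → ℕ)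
    (S : Spec w w.length P d) (q : ℕ) (hq : q ≤ w.length) (x : Letter) : d q x ≤ w.length := by
  have hpos := List.length_pos_iff.2 hw
  induction q using Nat.strong_induction_on with
  | _ q ih =>
    rcases q with _ | i
    · by_cases h : w[0]? = some x
      · rw [S.d0 x h]; omega
      · rw [S.d0' x h]; omega
    · rcases Nat.lt_or_ge (kt w i x) w.length with h | h
      · have h1 := S.good i (by omega) x h
        have := S.Ple (kt w i x) h.le
        unfold IsEdge at h1
        omega
      · have h2 : kt w i x = w.length := le_antisymm (kmp_le _ _) h
        rw [S.coll i (by omega) x h2]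
        have := S.Ple i (by omega)
        exact ih _ (by omega) (by omega)

theorem run_take (w : List Letter) (P : ℕ → ℕ) (d : ℕ → Letter → ℕ)
    (S : Spec w w.length P d) (i : ℕ) (hi : i < w.length) : (w.take i).foldl d 1 = i + 1 := by
  induction i with
  | zero => simp
  | succ i ih =>
    have hx : w[i]? = some w[i] := List.getElem?_eq_getElem (by omega)
    rw [← take_snoc w i _ hx, List.foldl_append, ih (by omega)]
    exact S.step i (by omega) _ hx hi

theorem run_const (w : List Letter) (P : ℕ → ℕ) (d : ℕ → Letter → ℕ)
    (S : Spec w w.length P d) (y : Letter) (hy : w[0]? ≠ some y) (hw : w ≠ [])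
    (q : ℕ) (hq : q ≤ w.length) :
    (List.replicate w.length y).foldl d q = 0 ∨ (List.replicate w.length y).foldl d q = 1 := by
  have hpos := List.length_pos_iff.2 hw
  have hk0 : ∀ s, kmp w (s ++ List.replicate w.length y) = 0 := by
    intro s
    apply kmp_eq _ _ _ (by omega) (by simp)
    intro j hj hs
    by_contra hc
    have h1 : w.take j <:+ List.replicate w.length y :=
      List.suffix_of_suffix_length_le hs (List.suffix_append _ _) (by simp)
    have h2 : w[0] ∈ w.take j := by
      rw [List.mem_take_iff_getElem]
      exact ⟨0, by omega, rfl⟩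
    have h3 := List.eq_of_mem_replicate (h1.subset h2)
    apply hy
    rw [List.getElem?_eq_getElem hpos, h3]
  induction q using Nat.strong_induction_on with
  | _ q ih =>
    rcases q with _ | i
    · rcases pair_run w P d S 0 hpos (List.replicate w.length y) with ⟨_, _, h⟩ | ⟨h, _⟩
      · rw [hk0] at h
        unfold IsEdge at h
        rw [S.P0] at h
        omega
      · exfalso
        have h2 : w[0] ∈ List.replicate w.length y := by
          have := h.subset (List.getElem_mem hpos)
          simpa using this
        have h3 := List.eq_of_mem_replicate h2
        apply hy
        rw [List.getElem?_eq_getElem hpos, h3]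
    · rcases pair_run w P d S i (by omega) (List.replicate w.length y) with ⟨_, _, h⟩ | ⟨_, h⟩
      · rw [hk0] at h
        unfold IsEdge at h
        rw [S.P0] at h
        omega
      · have := S.Ple i (by omega)
        rw [h]
        exact ih _ (by omega) (by omega)

/-- For every nonempty word w of length n over Σ = {a,b} there is a strongly connected
DFA with exactly n + 1 states whose set of synchronizing words is Σ* w Σ*. -/
theorem stmt5 (w : List Letter) (hw : w ≠ []) :
    ∃ δ : Fin (w.length + 1) → Letter → Fin (w.length + 1),
      (∀ p q : Fin (w.length + 1), ∃ u : List Letter, run δ p u = q) ∧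
      {u : List Letter | ∀ q q' : Fin (w.length + 1), run δ q u = run δ q' u} =
        {u : List Letter | w <:+: u} := by
  have hpos := List.length_pos_iff.2 hw
  obtain ⟨P, d, S⟩ := exists_spec w w.length le_rfl
  have hd : ∀ (q : Fin (w.length + 1)) x, d q x < w.length + 1 := fun q x =>
    Nat.lt_succ_of_le (d_le w hw P d S q (Nat.le_of_lt_succ q.2) x)
  refine ⟨fun q x => ⟨d q x, hd q x⟩, ?_, ?_⟩
  all_goals
    set δ : Fin (w.length + 1) → Letter → Fin (w.length + 1) := fun q x => ⟨d q x, hd q x⟩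
      with hδ
    have hrun : ∀ u (q : Fin (w.length + 1)), (run δ q u).val = u.foldl d q.val := by
      intro u
      unfold run
      induction u with
      | nil => intro q; rfl
      | cons x u ih => intro q; simp only [List.foldl_cons]; rw [ih]
  · obtain ⟨y, hy⟩ : ∃ y, w[0]? ≠ some y := by
      by_cases h : w[0]? = some Letter.a
      · exact ⟨Letter.b, by rw [h]; simp⟩
      · exact ⟨Letter.a, h⟩
    have hk : kt w 0 y = 0 := by
      have := kt_ne w 0 y hpos hy
      omega
    have hd0 := S.d0' y hy
    have hd1 : d 1 y = 0 := by
      have := S.good 0 hpos y (by omega)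
      rw [hk] at this
      unfold IsEdge at this
      rw [S.P0] at this
      simp only [Nat.zero_add] at this
      omega
    have to0 : ∀ p : ℕ, p ≤ w.length → ∃ u : List Letter, u.foldl d p = 0 := by
      intro p hp
      rcases run_const w P d S y hy hw p hp with h | h
      · exact ⟨_, h⟩
      · refine ⟨List.replicate w.length y ++ [y], ?_⟩
        rw [List.foldl_append, h]
        exact hd1
    have from0 : ∀ q : ℕ, q ≤ w.length → ∃ u : List Letter, u.foldl d 0 = q := by
      intro q hq
      rcases q with _ | i
      · exact ⟨[], rfl⟩
      · refine ⟨y :: w.take i, ?_⟩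
        rw [List.foldl_cons, hd0]
        exact run_take w P d S i (by omega)
    intro p q
    obtain ⟨u, hu⟩ := to0 p (by omega)
    obtain ⟨v, hv⟩ := from0 q (by omega)
    refine ⟨u ++ v, ?_⟩
    apply Fin.ext
    rw [hrun, List.foldl_append, hu, hv]
  · ext u
    simp only [Set.mem_setOf_eq]
    constructor
    · intro h
      rcases pair_run w P d S 0 hpos u with ⟨_, h2, h3⟩ | ⟨h, _⟩
      · exfalso
        have h4 := congrArg Fin.val (h ⟨1, by omega⟩ ⟨0, by omega⟩)
        rw [hrun, hrun] at h4
        simp only at h4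
        have h5 := S.Ple _ h2.le
        unfold IsEdge at h3
        rw [S.P0] at h3
        simp only [Nat.zero_add] at h3
        omega
      · simpa using h
    · intro h
      have all : ∀ q : ℕ, q ≤ w.length → u.foldl d q = u.foldl d 0 := by
        intro q
        induction q using Nat.strong_induction_on with
        | _ q ih =>
          intro hq
          rcases q with _ | i
          · rfl
          · have hs : w <:+: w.take i ++ u := h.trans (List.suffix_append _ _).isInfix
            rcases pair_run w P d S i (by omega) u with ⟨h1, _, _⟩ | ⟨_, h1⟩
            · exact absurd hs h1
            · have := S.Ple i (by omega)
              rw [h1]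
              exact ih _ (by omega) (by omega)
      intro q q'
      apply Fin.ext
      rw [hrun, hrun, all q (by omega), all q' (by omega)]
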